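/- Let b > a > 0, x ∈ ℝ^d, and let K be a cube containing B(x,a) with K ∩ ∂B(x,b) ≠ ∅. Let 𝒜 and ℬ be finite sets of points in ℝ^d with 𝒜 ⊂ B(x,a) and ℬ ⊂ K \ B(x,a). If ℬ contains a K-wall around B(x,a) in B(x,b), then |M(𝒜 ∪ ℬ) − M(ℬ)| ≤ c|𝒜|b for a constant c depending only on d. If such a wall does not exist, then |M(𝒜 ∪ ℬ) − M(ℬ)| ≤ c|𝒜|·diameter(K). -/

import Mathlib

open MeasureTheory Metric Set

noncomputable section

open Classical in
/-- Total edge weight of a graph (when its edge set is finite; `0` otherwise). -/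
def SimpleGraph.weightSum {V : Type*} (T : SimpleGraph V) (w : Sym2 V → ℝ) : ℝ :=
  if h : T.edgeSet.Finite then ∑ e ∈ h.toFinset, w e else 0

/-- `T` is a spanning tree of `G`. -/
def SimpleGraph.IsSpanningTreeOf {V : Type*} (T G : SimpleGraph V) : Prop :=
  T ≤ G ∧ T.Connected ∧ T.IsAcyclic

/-- Weight of a minimal spanning tree of `G` under edge weights `w`. -/
def mstWeight {V : Type*} (G : SimpleGraph V) (w : Sym2 V → ℝ) : ℝ :=
  sInf ((fun T => SimpleGraph.weightSum T w) '' {T | T.IsSpanningTreeOf G})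

/-- Euclidean edge weights on the complete graph on a set of points. -/
def euclWeight {d : ℕ} (s : Set (EuclideanSpace ℝ (Fin d))) : Sym2 s → ℝ :=
  Sym2.lift ⟨fun x y => dist (x : EuclideanSpace ℝ (Fin d)) (y : EuclideanSpace ℝ (Fin d)),
    fun _ _ => dist_comm _ _⟩

/-- Weight of a Euclidean minimal spanning tree of the complete graph on `s`. -/
def euclMST {d : ℕ} (s : Set (EuclideanSpace ℝ (Fin d))) : ℝ :=
  mstWeight (⊤ : SimpleGraph s) (euclWeight s)

/-- The closed `L^∞`-ball (a cube) `x + [-a,a]^d`. -/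
def box {d : ℕ} (x : EuclideanSpace ℝ (Fin d)) (a : ℝ) : Set (EuclideanSpace ℝ (Fin d)) :=
  {y | ∀ i, |y i - x i| ≤ a}

/-- `K` is a cube. -/
def IsCube {d : ℕ} (K : Set (EuclideanSpace ℝ (Fin d))) : Prop :=
  ∃ z s, 0 < s ∧ K = box z s

/-- `W` contains a `K`-wall around `B(x,a)` in `B(x,b)`: for any `p₁ ∈ ∂B(x,a)` and
`p₂ ∈ K ∩ ∂B(x,b)`, the set
`K ∩ W ∩ S(p₁, 3d(p₁,p₂)/4) ∩ S(p₂, 3d(p₁,p₂)/4) ∩ (B(x,b) \ B(x,a))` is nonempty. -/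
def ContainsWall {d : ℕ} (W K : Set (EuclideanSpace ℝ (Fin d)))
    (x : EuclideanSpace ℝ (Fin d)) (a b : ℝ) : Prop :=
  ∀ p₁ ∈ frontier (box x a), ∀ p₂ ∈ K ∩ frontier (box x b),
    (K ∩ W ∩ closedBall p₁ (3 * dist p₁ p₂ / 4) ∩
      closedBall p₂ (3 * dist p₁ p₂ / 4) ∩ (box x b \ box x a)).Nonempty

end

section EdgeSets

variable {X : Type*}

/-- Two points are linked by a set of edges if a path along these edges joins them. -/
def Linked (F : Finset (Sym2 X)) : X → X → Prop :=
  Relation.ReflTransGen fun u v => s(u, v) ∈ F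

namespace Linked

variable {F G : Finset (Sym2 X)} {u v w : X}

theorem refl (F : Finset (Sym2 X)) (u : X) : Linked F u u := Relation.ReflTransGen.refl

theorem of_mem (h : s(u, v) ∈ F) : Linked F u v := Relation.ReflTransGen.single h

theorem trans (h : Linked F u v) (h' : Linked F v w) : Linked F u w :=
  Relation.ReflTransGen.trans h h'

theorem symm (h : Linked F u v) : Linked F v u := by
  induction h with
  | refl => exact refl F _
  | tail _ h ih => exact (of_mem (Sym2.eq_swap ▸ h)).trans ih

theorem map (f : X → X) (h : ∀ u v, s(u, v) ∈ F → Linked G (f u) (f v)) (huv : Linked F u v) :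
    Linked G (f u) (f v) := by
  induction huv with
  | refl => exact refl G _
  | tail _ hb ih => exact ih.trans (h _ _ hb)

theorem mono (h : F ⊆ G) (huv : Linked F u v) : Linked G u v :=
  huv.map id fun _ _ h' => of_mem (h h')

/-- Removing an edge `pq` leaves every point that was linked to `p` linked to `p` or to `q`. -/
theorem erase [DecidableEq X] {p q : X} (h : Linked F p v) :
    Linked (F.erase s(p, q)) p v ∨ Linked (F.erase s(p, q)) q v := by
  induction h with
  | refl => exact Or.inl (refl _ _)
  | @tail b c _ hbc ih =>
    by_cases he : s(b, c) = s(p, q)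
    · rcases Sym2.eq_iff.1 he with ⟨-, rfl⟩ | ⟨-, rfl⟩
      · exact Or.inr (refl _ _)
      · exact Or.inl (refl _ _)
    · have hl := of_mem (Finset.mem_erase.2 ⟨he, hbc⟩)
      exact ih.imp (·.trans hl) (·.trans hl)

theorem exists_adj (h : Linked F u v) (huv : u ≠ v) : ∃ w, w ≠ u ∧ s(u, w) ∈ F := by
  induction h with
  | refl => exact absurd rfl huv
  | @tail b c _ hbc ih =>
    by_cases hb : u = b
    · exact ⟨c, huv.symm, hb ▸ hbc⟩
    · exact ih hb

end Linked

/-- The edge set `F` forms a connected graph on the vertex set `S`. -/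
structure Connects (F : Finset (Sym2 X)) (S : Finset X) : Prop where
  subset : F ⊆ S.sym2
  linked : ∀ u ∈ S, ∀ v ∈ S, Linked F u v

namespace Connects

variable {F : Finset (Sym2 X)} {S : Finset X}

/-- Adding a vertex joined to `q`. -/
theorem insert_vertex [DecidableEq X] (h : Connects F S) (p : X) {q : X} (hq : q ∈ S) :
    Connects (insert s(p, q) F) (insert p S) := by
  have hlink : ∀ u ∈ insert p S, Linked (insert s(p, q) F) u q := by
    intro u hu
    rcases Finset.mem_insert.1 hu with rfl | hu
    · exact .of_mem (Finset.mem_insert_self _ _)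
    · exact (h.linked u hu q hq).mono (Finset.subset_insert _ _)
  refine ⟨?_, fun u hu v hv => (hlink u hu).trans (hlink v hv).symm⟩
  refine Finset.insert_subset ?_ (h.subset.trans (Finset.sym2_mono (Finset.subset_insert _ _)))
  simp [hq]

/-- Exchanging an edge `pq` for an edge `e` that reconnects `p` with `q`. -/
theorem exchange [DecidableEq X] (h : Connects F S) {p q : X} {e : Sym2 X} (he : e ∈ S.sym2)
    (hpq : Linked (insert e (F.erase s(p, q))) p q) :
    Connects (insert e (F.erase s(p, q))) S := by
  refine ⟨Finset.insert_subset he ((Finset.erase_subset _ _).trans h.subset), fun u hu v hv => ?_⟩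
  refine (h.linked u hu v hv).map id fun a b hab => ?_
  by_cases hab' : s(a, b) = s(p, q)
  · rcases Sym2.eq_iff.1 hab' with ⟨rfl, rfl⟩ | ⟨rfl, rfl⟩
    · exact hpq
    · exact hpq.symm
  · exact .of_mem (Finset.mem_insert_of_mem (Finset.mem_erase.2 ⟨hab', hab⟩))

/-- Removing a vertex `p` and joining all its neighbours to one of them. -/
theorem remove_vertex [DecidableEq X] {p q : X} (h : Connects F (insert p S))
    (hp : p ∉ S) (hq : q ∈ S) (hpq : s(p, q) ∈ F) :
    Connects (F.filter (p ∉ ·) ∪ (S.filter fun r => s(p, r) ∈ F).image fun r => s(q, r)) S := by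
  set G := F.filter (p ∉ ·) ∪ (S.filter fun r => s(p, r) ∈ F).image fun r => s(q, r) with hG
  have hnb : ∀ r, r ≠ p → s(p, r) ∈ F → Linked G q r := by
    intro r hr hpr
    have hrS : r ∈ S :=
      Finset.mem_of_mem_insert_of_ne (Finset.mk_mem_sym2_iff.1 (h.subset hpr)).2 hr
    refine .of_mem (Finset.mem_union_right _ ?_)
    exact Finset.mem_image_of_mem _ (Finset.mem_filter.2 ⟨hrS, hpr⟩)
  constructor
  · refine Finset.union_subset (fun e he => ?_) (fun e he => ?_)
    · rw [Finset.mem_filter] at he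
      rw [Finset.mem_sym2_iff]
      intro v hv
      refine Finset.mem_of_mem_insert_of_ne (Finset.mem_sym2_iff.1 (h.subset he.1) v hv) ?_
      rintro rfl
      exact he.2 hv
    · obtain ⟨r, hr, rfl⟩ := Finset.mem_image.1 he
      exact Finset.mk_mem_sym2_iff.2 ⟨hq, (Finset.mem_filter.1 hr).1⟩
  · intro u hu v hv
    have key := (h.linked u (Finset.mem_insert_of_mem hu) v (Finset.mem_insert_of_mem hv)).map
      (G := G) (fun r => if r = p then q else r) ?_
    · simpa [ne_of_mem_of_not_mem hu hp, ne_of_mem_of_not_mem hv hp] using key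
    · intro r t hrt
      by_cases hr : r = p <;> by_cases ht : t = p
      · simpa [hr, ht] using Linked.refl G q
      · subst hr
        simpa [ht] using hnb t ht hrt
      · subst ht
        simpa [hr] using (hnb r hr (Sym2.eq_swap ▸ hrt)).symm
      · simp only [hr, ht, if_false]
        refine .of_mem (Finset.mem_union_left _ (Finset.mem_filter.2 ⟨hrt, ?_⟩))
        simp [Ne.symm hr, Ne.symm ht]

end Connects

end EdgeSets

section MinimalEdgeSets

variable {X : Type*} [PseudoMetricSpace X]

/-- The length of an edge in a (pseudo)metric space. -/
noncomputable def edgeLength : Sym2 X → ℝ :=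
  Sym2.lift ⟨fun x y => dist x y, fun _ _ => dist_comm _ _⟩

@[simp]
theorem edgeLength_mk (x y : X) : edgeLength s(x, y) = dist x y := rfl

theorem edgeLength_nonneg (e : Sym2 X) : 0 ≤ edgeLength e := by
  induction e with
  | _ x y => exact dist_nonneg

/-- The total length of a finite set of edges. -/
noncomputable def totalLength (F : Finset (Sym2 X)) : ℝ := ∑ e ∈ F, edgeLength e

theorem totalLength_insert_le [DecidableEq X] (e : Sym2 X) (F : Finset (Sym2 X)) :
    totalLength (insert e F) ≤ totalLength F + edgeLength e := by
  unfold totalLength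
  by_cases h : e ∈ F
  · rw [Finset.insert_eq_of_mem h]
    linarith [edgeLength_nonneg e]
  · rw [Finset.sum_insert h, add_comm]

theorem totalLength_union_le [DecidableEq X] (F G : Finset (Sym2 X)) :
    totalLength (F ∪ G) ≤ totalLength F + totalLength G := by
  unfold totalLength
  rw [← Finset.sum_union_inter]
  exact le_add_of_nonneg_right (Finset.sum_nonneg fun e _ => edgeLength_nonneg e)

theorem totalLength_mono {F G : Finset (Sym2 X)} (h : F ⊆ G) : totalLength F ≤ totalLength G :=
  Finset.sum_le_sum_of_subset_of_nonneg h fun e _ _ => edgeLength_nonneg e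

theorem totalLength_erase [DecidableEq X] {e : Sym2 X} {F : Finset (Sym2 X)} (h : e ∈ F) :
    totalLength (F.erase e) = totalLength F - edgeLength e := by
  have := Finset.sum_erase_add F edgeLength h
  unfold totalLength
  linarith

/-- A connected edge set on `S` of minimal total length. -/
structure IsMinimalConnecting (F : Finset (Sym2 X)) (S : Finset X) : Prop
    extends Connects F S where
  le : ∀ G, Connects G S → totalLength F ≤ totalLength G

namespace IsMinimalConnecting

variable {F : Finset (Sym2 X)} {S : Finset X}

theorem edgeLength_le_of_exchange [DecidableEq X] (h : IsMinimalConnecting F S) {p q : X}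
    {e : Sym2 X} (hpqF : s(p, q) ∈ F) (he : e ∈ S.sym2)
    (hpq : Linked (insert e (F.erase s(p, q))) p q) : dist p q ≤ edgeLength e := by
  have h₁ := h.le _ (h.toConnects.exchange he hpq)
  have h₂ := totalLength_insert_le e (F.erase s(p, q))
  rw [totalLength_erase hpqF, edgeLength_mk] at h₂
  linarith

/-- The longest edge of a triangle is not in a minimal connecting edge set. -/
theorem dist_le_max (h : IsMinimalConnecting F S) {p q z : X} (hpq : s(p, q) ∈ F) (hz : z ∈ S) :
    dist p q ≤ max (dist z p) (dist z q) := by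
  classical
  obtain ⟨hp, hq⟩ := Finset.mk_mem_sym2_iff.1 (h.subset hpq)
  rcases (h.linked p hp z hz).erase (q := q) with hl | hl
  · refine le_max_of_le_right (h.edgeLength_le_of_exchange hpq (e := s(z, q)) (by simp [hz, hq]) ?_)
    exact (hl.mono (Finset.subset_insert _ _)).trans (.of_mem (Finset.mem_insert_self _ _))
  · refine le_max_of_le_left (h.edgeLength_le_of_exchange hpq (e := s(z, p)) (by simp [hz, hp]) ?_)
    exact ((hl.mono (Finset.subset_insert _ _)).trans (.of_mem (Finset.mem_insert_self _ _))).symm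

/-- Two neighbours of a vertex are at least as far from each other as from that vertex. -/
theorem dist_le_dist_of_adj (h : IsMinimalConnecting F S) {p q r : X} (hpq : s(p, q) ∈ F)
    (hpr : s(p, r) ∈ F) (hqr : q ≠ r) : dist p q ≤ dist q r := by
  classical
  have hr := (Finset.mk_mem_sym2_iff.1 (h.subset hpr)).2
  have hq := (Finset.mk_mem_sym2_iff.1 (h.subset hpq)).2
  refine h.edgeLength_le_of_exchange hpq (e := s(q, r)) (by simp [hq, hr]) ?_
  refine (Linked.of_mem (v := r) (Finset.mem_insert_of_mem (Finset.mem_erase.2 ⟨?_, hpr⟩))).trans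
    (Linked.of_mem (Finset.mem_insert_self _ _)).symm
  exact fun h' => hqr (Sym2.congr_right.1 h').symm

end IsMinimalConnecting

end MinimalEdgeSets

section MinimumSpanningTree

variable {d : ℕ}

theorem euclWeight_eq_edgeLength {s : Set (EuclideanSpace ℝ (Fin d))} (e : Sym2 s) :
    euclWeight s e = edgeLength (e.map Subtype.val) := by
  induction e with
  | _ x y => rfl

theorem weightSum_euclWeight {s : Set (EuclideanSpace ℝ (Fin d))} {T : SimpleGraph s}
    (hT : T.edgeSet.Finite) :
    T.weightSum (euclWeight s) =
      totalLength (hT.toFinset.map ⟨Sym2.map Subtype.val, Sym2.map.injective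
        Subtype.val_injective⟩) := by
  rw [SimpleGraph.weightSum, dif_pos hT, totalLength, Finset.sum_map]
  exact Finset.sum_congr rfl fun e _ => euclWeight_eq_edgeLength e

theorem euclMST_le_totalLength {F : Finset (Sym2 (EuclideanSpace ℝ (Fin d)))}
    {S : Finset (EuclideanSpace ℝ (Fin d))} (h : Connects F S) (hS : S.Nonempty) :
    euclMST (S : Set (EuclideanSpace ℝ (Fin d))) ≤ totalLength F := by
  set V := (S : Set (EuclideanSpace ℝ (Fin d)))
  let G : SimpleGraph V :=
    { Adj := fun u v => u ≠ v ∧ s((u : EuclideanSpace ℝ (Fin d)), (v : _)) ∈ F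
      symm := ⟨fun u v huv => ⟨huv.1.symm, Sym2.eq_swap ▸ huv.2⟩⟩
      loopless := ⟨fun u hu => hu.1 rfl⟩ }
  have hreach : ∀ (u : V) (v : EuclideanSpace ℝ (Fin d)), Linked F u v →
      ∃ hv : v ∈ V, G.Reachable u ⟨v, hv⟩ := by
    intro u v huv
    induction huv with
    | refl => exact ⟨u.2, SimpleGraph.Reachable.refl _⟩
    | @tail b c _ hbc ih =>
      obtain ⟨hb, hub⟩ := ih
      have hc : c ∈ V := (Finset.mk_mem_sym2_iff.1 (h.subset hbc)).2
      refine ⟨hc, ?_⟩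
      by_cases hne : b = c
      · subst hne
        exact hub
      · refine hub.trans (SimpleGraph.Adj.reachable (G := G) ⟨?_, hbc⟩)
        simpa using hne
  have hconn : G.Connected :=
    { preconnected := fun u v => (hreach u v (h.linked u u.2 v v.2)).2
      nonempty := hS.to_subtype }
  obtain ⟨T, hTG, hT⟩ := hconn.exists_isTree_le
  have hfin : T.edgeSet.Finite := Set.toFinite _
  calc euclMST V ≤ T.weightSum (euclWeight V) := by
        refine csInf_le ⟨0, ?_⟩ ⟨T, ⟨le_top, hT.connected, hT.isAcyclic⟩, rfl⟩
        rintro _ ⟨T', -, rfl⟩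
        exact (Finset.sum_nonneg fun e _ => edgeLength_nonneg e).trans_eq
          (weightSum_euclWeight (Set.toFinite T'.edgeSet)).symm
    _ = _ := weightSum_euclWeight hfin
    _ ≤ totalLength F := by
        refine totalLength_mono fun e he => ?_
        obtain ⟨e, he', rfl⟩ := Finset.mem_map.1 he
        rw [Set.Finite.mem_toFinset] at he'
        induction e with
        | _ u v => exact (hTG he').2

/-- The minimum spanning tree weight is the least total length of a connecting edge set. -/
theorem exists_isMinimalConnecting {S : Finset (EuclideanSpace ℝ (Fin d))} (hS : S.Nonempty) :
    ∃ F, IsMinimalConnecting F S ∧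
      totalLength F = euclMST (S : Set (EuclideanSpace ℝ (Fin d))) := by
  set V := (S : Set (EuclideanSpace ℝ (Fin d))) with hV
  have : Nonempty V := hS.to_subtype
  obtain ⟨T₀, hT₀, hT₀'⟩ := (SimpleGraph.connected_top (V := V)).exists_isTree_le
  obtain ⟨T, ⟨-, hT, -⟩, hTw⟩ := Set.Nonempty.csInf_mem
    (s := (fun T => SimpleGraph.weightSum T (euclWeight V)) '' {T | T.IsSpanningTreeOf ⊤})
    ⟨_, T₀, ⟨hT₀, hT₀'.connected, hT₀'.isAcyclic⟩, rfl⟩ (Set.toFinite _)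
  have hfin : T.edgeSet.Finite := Set.toFinite _
  have hw := weightSum_euclWeight hfin
  set F := hfin.toFinset.map ⟨Sym2.map Subtype.val, Sym2.map.injective Subtype.val_injective⟩
    with hF
  have hFw : totalLength F = euclMST V := hw.symm.trans hTw
  refine ⟨F, ⟨⟨fun e he => ?_, fun u hu v hv => ?_⟩, fun G hG => ?_⟩, hFw⟩
  · obtain ⟨e, -, rfl⟩ := Finset.mem_map.1 he
    induction e with
    | _ u v => exact Finset.mk_mem_sym2_iff.2 ⟨u.2, v.2⟩
  · have huv := (SimpleGraph.reachable_iff_reflTransGen _ _).1 (hT.preconnected ⟨u, hu⟩ ⟨v, hv⟩)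
    refine Relation.ReflTransGen.lift (Subtype.val : V → _) (fun a b hab => ?_) _ _ huv
    exact Finset.mem_map.2 ⟨s(a, b), by simpa using hab, rfl⟩
  · rw [hFw]
    exact euclMST_le_totalLength hG hS

theorem euclMST_empty : euclMST (∅ : Set (EuclideanSpace ℝ (Fin d))) = 0 := by
  have : {T : SimpleGraph (∅ : Set (EuclideanSpace ℝ (Fin d))) | T.IsSpanningTreeOf ⊤} = ∅ := by
    refine Set.eq_empty_of_forall_notMem fun T hT => ?_
    obtain ⟨v⟩ := hT.2.1.nonempty
    exact v.2
  rw [euclMST, mstWeight, this, Set.image_empty, Real.sInf_empty]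

theorem euclMST_singleton (p : EuclideanSpace ℝ (Fin d)) :
    euclMST (({p} : Finset (EuclideanSpace ℝ (Fin d))) : Set (EuclideanSpace ℝ (Fin d))) = 0 := by
  obtain ⟨F, -, hF⟩ := exists_isMinimalConnecting (Finset.singleton_nonempty p)
  refine le_antisymm ?_ (hF ▸ Finset.sum_nonneg fun e _ => edgeLength_nonneg e)
  refine (euclMST_le_totalLength (F := ∅) ⟨Finset.empty_subset _, fun u hu v hv => ?_⟩
    (Finset.singleton_nonempty p)).trans_eq Finset.sum_empty
  rw [Finset.mem_singleton.1 hu, Finset.mem_singleton.1 hv]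
  exact .refl _ _

end MinimumSpanningTree

section Degree

variable {E : Type*} [NormedAddCommGroup E] [InnerProductSpace ℝ E]

theorem norm_inv_norm_smul {u : E} (hu : u ≠ 0) : ‖‖u‖⁻¹ • u‖ = 1 :=
  norm_smul_inv_norm (𝕜 := ℝ) hu

/-- If `u` and `v` are at least as far from each other as from the origin, then they subtend an
angle of at least `π / 3` there. -/
theorem one_le_norm_normalize_sub_normalize {u v : E} (hu : u ≠ 0) (hv : v ≠ 0)
    (hu' : ‖u‖ ≤ ‖u - v‖) (hv' : ‖v‖ ≤ ‖u - v‖) : 1 ≤ ‖‖u‖⁻¹ • u - ‖v‖⁻¹ • v‖ := by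
  have hu0 := norm_pos_iff.2 hu
  have hv0 := norm_pos_iff.2 hv
  have hinner : 2 * inner ℝ u v ≤ ‖u‖ * ‖v‖ := by
    have h := norm_sub_sq_real u v
    rcases le_total ‖u‖ ‖v‖ with huv | huv <;> nlinarith
  have h := norm_sub_sq_real (‖u‖⁻¹ • u) (‖v‖⁻¹ • v)
  rw [norm_inv_norm_smul hu, norm_inv_norm_smul hv, real_inner_smul_left,
    real_inner_smul_right] at h
  have : ‖u‖⁻¹ * (‖v‖⁻¹ * inner ℝ u v) ≤ 1 / 2 := by
    rw [← mul_assoc, ← mul_inv, inv_mul_le_iff₀ (by positivity)]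
    linarith
  nlinarith [norm_nonneg (‖u‖⁻¹ • u - ‖v‖⁻¹ • v)]

theorem card_le_of_dist_le_dist [FiniteDimensional ℝ E] {p : E} (N : Finset E) (hp : p ∉ N)
    (hN : ∀ q ∈ N, ∀ r ∈ N, q ≠ r → dist p q ≤ dist q r) :
    N.card ≤ 5 ^ Module.finrank ℝ E := by
  classical
  set f : E → E := fun q => ‖q - p‖⁻¹ • (q - p) with hf
  have hne : ∀ q ∈ N, q - p ≠ 0 := fun q hq => sub_ne_zero.2 (ne_of_mem_of_not_mem hq hp)
  have hsep : ∀ q ∈ N, ∀ r ∈ N, q ≠ r → 1 ≤ ‖f q - f r‖ := by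
    intro q hq r hr hqr
    refine one_le_norm_normalize_sub_normalize (hne q hq) (hne r hr) ?_ ?_
    · simpa [← dist_eq_norm, dist_comm] using hN q hq r hr hqr
    · simpa [← dist_eq_norm, dist_comm] using hN r hr q hq hqr.symm
  have hinj : Set.InjOn f N := by
    intro q hq r hr hqr
    by_contra hne'
    have := hsep q hq r hr hne'
    rw [hqr, sub_self, norm_zero] at this
    exact absurd this (by norm_num)
  rw [← Finset.card_image_of_injOn hinj]
  apply Besicovitch.card_le_of_separated
  · intro c hc
    obtain ⟨q, hq, rfl⟩ := Finset.mem_image.1 hc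
    exact (norm_inv_norm_smul (hne q hq)).trans_le one_le_two
  · intro c hc c' hc' hcc
    obtain ⟨q, hq, rfl⟩ := Finset.mem_image.1 hc
    obtain ⟨r, hr, rfl⟩ := Finset.mem_image.1 hc'
    exact hsep q hq r hr fun h => hcc (h ▸ rfl)

end Degree

section Stability

variable {d : ℕ} {S : Finset (EuclideanSpace ℝ (Fin d))} {p : EuclideanSpace ℝ (Fin d)} {D : ℝ}

open Classical in
theorem euclMST_insert_le {q : EuclideanSpace ℝ (Fin d)} (hq : q ∈ S) :
    euclMST ((insert p S : Finset _) : Set (EuclideanSpace ℝ (Fin d))) ≤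
      euclMST (S : Set (EuclideanSpace ℝ (Fin d))) + dist p q := by
  obtain ⟨F, hF, hFw⟩ := exists_isMinimalConnecting ⟨q, hq⟩
  rw [← hFw]
  exact (euclMST_le_totalLength (hF.insert_vertex p hq) (Finset.insert_nonempty _ _)).trans
    (totalLength_insert_le _ _)

open Classical in
theorem euclMST_le_insert (hS : S.Nonempty) (hp : p ∉ S)
    (hD : ∀ q ∈ S, D < dist p q → ∃ z ∈ S, dist z p < dist p q ∧ dist z q < dist p q) :
    euclMST (S : Set (EuclideanSpace ℝ (Fin d))) ≤
      euclMST ((insert p S : Finset _) : Set (EuclideanSpace ℝ (Fin d))) + 5 ^ d * (2 * D) := by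
  obtain ⟨F, hF, hFw⟩ := exists_isMinimalConnecting (Finset.insert_nonempty p S)
  rw [← hFw]
  set N := S.filter fun q => s(p, q) ∈ F with hN
  have hND : ∀ q ∈ N, dist p q ≤ D := by
    intro q hq
    obtain ⟨hqS, hqF⟩ := Finset.mem_filter.1 hq
    by_contra! hlt
    obtain ⟨z, hz, hzp, hzq⟩ := hD q hqS hlt
    exact absurd (hF.dist_le_max hqF (Finset.mem_insert_of_mem hz)) (not_le.2 (max_lt hzp hzq))
  have hcard : N.card ≤ 5 ^ d := by
    have := card_le_of_dist_le_dist (p := p) N (fun h => hp (Finset.mem_filter.1 h).1)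
      fun q hq r hr => hF.dist_le_dist_of_adj (Finset.mem_filter.1 hq).2 (Finset.mem_filter.1 hr).2
    simpa using this
  obtain ⟨q, hq⟩ : ∃ q, q ∈ N := by
    obtain ⟨y, hy⟩ := hS
    obtain ⟨q, hqp, hq⟩ := (hF.linked p (Finset.mem_insert_self _ _) y
      (Finset.mem_insert_of_mem hy)).exists_adj (ne_of_mem_of_not_mem hy hp).symm
    exact ⟨q, Finset.mem_filter.2 ⟨Finset.mem_of_mem_insert_of_ne
      (Finset.mk_mem_sym2_iff.1 (hF.subset hq)).2 hqp, hq⟩⟩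
  obtain ⟨hqS, hqF⟩ := Finset.mem_filter.1 hq
  have hD0 : 0 ≤ D := dist_nonneg.trans (hND q hq)
  calc euclMST (S : Set (EuclideanSpace ℝ (Fin d)))
      ≤ totalLength (F.filter (p ∉ ·) ∪ N.image fun r => s(q, r)) :=
        euclMST_le_totalLength (hF.remove_vertex hp hqS hqF) hS
    _ ≤ totalLength (F.filter (p ∉ ·)) + totalLength (N.image fun r => s(q, r)) :=
        totalLength_union_le _ _
    _ ≤ totalLength F + N.card • (2 * D) := by
        refine add_le_add (totalLength_mono (Finset.filter_subset _ _)) ?_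
        refine (Finset.sum_le_card_nsmul _ _ (2 * D) fun e he => ?_).trans
          (nsmul_le_nsmul_left (by positivity) Finset.card_image_le)
        obtain ⟨r, hr, rfl⟩ := Finset.mem_image.1 he
        rw [edgeLength_mk]
        linarith [dist_triangle_left q r p, hND q hq, hND r hr]
    _ ≤ totalLength F + 5 ^ d * (2 * D) := by
        rw [nsmul_eq_mul]
        have : (N.card : ℝ) ≤ 5 ^ d := by exact_mod_cast hcard
        gcongr

open Classical in
/-- Adding one point changes the weight of the minimum spanning tree by a bounded multiple of `D`
if this point has a neighbour within distance `D` and all longer edges can be avoided. -/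
theorem abs_euclMST_insert_sub_le (hp : p ∉ S) (hD0 : 0 ≤ D)
    (hnear : S.Nonempty → ∃ q ∈ S, dist p q ≤ D)
    (hD : ∀ q ∈ S, D < dist p q → ∃ z ∈ S, dist z p < dist p q ∧ dist z q < dist p q) :
    |euclMST ((insert p S : Finset _) : Set (EuclideanSpace ℝ (Fin d))) -
      euclMST (S : Set (EuclideanSpace ℝ (Fin d)))| ≤ 5 ^ d * (2 * D) := by
  rcases S.eq_empty_or_nonempty with rfl | hS
  · rw [insert_empty_eq, euclMST_singleton, Finset.coe_empty, euclMST_empty, sub_zero, abs_zero]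
    positivity
  · obtain ⟨q, hq, hqD⟩ := hnear hS
    have h₁ := euclMST_insert_le (p := p) hq
    have h₂ := euclMST_le_insert hS hp hD
    have h₃ : D ≤ 5 ^ d * (2 * D) := by
      have : (1 : ℝ) ≤ 5 ^ d := one_le_pow₀ (by norm_num)
      nlinarith
    rw [abs_le]
    constructor <;> linarith

/-- Adding the points of `𝒜` one by one. -/
theorem abs_euclMST_union_sub_le {𝒜 ℬ : Finset (EuclideanSpace ℝ (Fin d))}
    (hdisj : Disjoint 𝒜 ℬ) (hD0 : 0 ≤ D)
    (hnear : ∀ p ∈ 𝒜, ∀ q ∈ 𝒜, dist p q ≤ D)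
    (hnear' : ∀ p ∈ 𝒜, ℬ.Nonempty → ∃ q ∈ ℬ, dist p q ≤ D)
    (hD : ∀ p ∈ 𝒜, ∀ q ∈ ℬ, D < dist p q → ∃ z ∈ ℬ, dist z p < dist p q ∧ dist z q < dist p q) :
    |euclMST ((𝒜 : Set (EuclideanSpace ℝ (Fin d))) ∪ (ℬ : Set (EuclideanSpace ℝ (Fin d)))) -
      euclMST (ℬ : Set (EuclideanSpace ℝ (Fin d)))| ≤ 5 ^ d * (2 * D) * 𝒜.card := by
  classical
  induction 𝒜 using Finset.induction_on with
  | empty => simp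
  | insert p 𝒜 hp ih =>
    have hsub := Finset.subset_insert p 𝒜
    have hpm := Finset.mem_insert_self p 𝒜
    have ih' := ih (hdisj.mono_left hsub) (fun q hq r hr => hnear q (hsub hq) r (hsub hr))
      (fun q hq => hnear' q (hsub hq)) fun q hq => hD q (hsub hq)
    have hpℬ : p ∉ ℬ := Finset.disjoint_left.1 hdisj hpm
    have hstep := abs_euclMST_insert_sub_le (S := 𝒜 ∪ ℬ) (p := p) (D := D)
      (by simp [hp, hpℬ]) hD0 ?_ ?_
    · rw [← Finset.insert_union, Finset.coe_union, Finset.coe_union] at hstep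
      rw [Finset.card_insert_of_notMem hp]
      push_cast at hstep ⊢
      refine (abs_sub_le _ _ _).trans ((add_le_add hstep ih').trans_eq ?_)
      ring
    · intro _
      rcases 𝒜.eq_empty_or_nonempty with rfl | ⟨q, hq⟩
      · obtain ⟨q, hq, hqD⟩ := hnear' p hpm (by simp_all)
        exact ⟨q, Finset.mem_union_right _ hq, hqD⟩
      · exact ⟨q, Finset.mem_union_left _ hq, hnear p hpm q (hsub hq)⟩
    · intro q hq hlt
      rcases Finset.mem_union.1 hq with hq | hq
      · exact absurd (hnear p hpm q (hsub hq)) (not_le.2 hlt)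
      · obtain ⟨z, hz, h⟩ := hD p hpm q hq hlt
        exact ⟨z, Finset.mem_union_right _ hz, h⟩

end Stability

section Walls

theorem IsPreconnected.inter_frontier_nonempty {X : Type*} [TopologicalSpace X] {s t : Set X}
    (ht : IsPreconnected t) (hin : (t ∩ s).Nonempty) (hout : (t ∩ sᶜ).Nonempty) :
    (t ∩ frontier s).Nonempty := by
  by_contra hempty
  have hdich : ∀ y ∈ t, y ∈ interior s ∨ y ∈ interior sᶜ := by
    intro y hy
    by_contra! h
    refine hempty ⟨y, hy, ?_, h.1⟩
    rw [interior_compl] at h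
    exact not_not.1 h.2
  obtain ⟨y, hyt, hys⟩ := hin
  obtain ⟨z, hzt, hzs⟩ := hout
  obtain ⟨w, -, hw, hw'⟩ := ht _ _ isOpen_interior isOpen_interior hdich
    ⟨y, hyt, (hdich y hyt).resolve_right fun h => interior_subset h hys⟩
    ⟨z, hzt, (hdich z hzt).resolve_left fun h => hzs (interior_subset h)⟩
  exact interior_subset hw' (interior_subset hw)

variable {d : ℕ} {x : EuclideanSpace ℝ (Fin d)} {a b : ℝ}

theorem box_eq_iInter (x : EuclideanSpace ℝ (Fin d)) (a : ℝ) :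
    box x a = ⋂ i, {y | |y i - x i| ≤ a} := by
  ext y
  simp [box]

theorem isClosed_box (x : EuclideanSpace ℝ (Fin d)) (a : ℝ) : IsClosed (box x a) := by
  rw [box_eq_iInter]
  exact isClosed_iInter fun i => isClosed_le (by fun_prop) continuous_const

theorem convex_box (x : EuclideanSpace ℝ (Fin d)) (a : ℝ) : Convex ℝ (box x a) := by
  intro y hy z hz s t hs ht hst i
  calc |(s • y + t • z) i - x i| = |s * (y i - x i) + t * (z i - x i)| := by
        congr 1
        simp only [PiLp.add_apply, PiLp.smul_apply, smul_eq_mul]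
        linear_combination (x i) * hst
    _ ≤ s * |y i - x i| + t * |z i - x i| := by
        refine (abs_add_le _ _).trans_eq ?_
        rw [abs_mul, abs_mul, abs_of_nonneg hs, abs_of_nonneg ht]
    _ ≤ s * a + t * a := by gcongr <;> apply_assumption
    _ = a := by rw [← add_mul, hst, one_mul]

theorem box_mono (hab : a ≤ b) : box x a ⊆ box x b := fun _ hy i => (hy i).trans hab

theorem box_subset_interior (hab : a < b) : box x a ⊆ interior (box x b) := by
  have hopen : IsOpen (⋂ i, {y : EuclideanSpace ℝ (Fin d) | |y i - x i| < b}) :=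
    isOpen_iInter_of_finite fun i => isOpen_lt (by fun_prop) continuous_const
  refine Set.Subset.trans (fun y hy => ?_) (interior_maximal (fun y hy i => ?_) hopen)
  · exact Set.mem_iInter.2 fun i => (hy i).trans_lt hab
  · exact (Set.mem_iInter.1 hy i).le

theorem dist_le_of_mem_box (hb : 0 ≤ b) {y z : EuclideanSpace ℝ (Fin d)} (hy : y ∈ box x b)
    (hz : z ∈ box x b) : dist y z ≤ 2 * b * √d := by
  rw [EuclideanSpace.dist_eq]
  refine Real.sqrt_le_iff.2 ⟨by positivity, ?_⟩
  have : ∀ i ∈ Finset.univ, dist (y i) (z i) ^ 2 ≤ (2 * b) ^ 2 := by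
    intro i _
    have := dist_triangle_right (y i) (z i) (x i)
    rw [Real.dist_eq (y i) (x i), Real.dist_eq (z i) (x i)] at this
    gcongr
    linarith [hy i, hz i]
  refine (Finset.sum_le_card_nsmul _ _ _ this).trans_eq ?_
  rw [mul_pow (2 * b) √d, Real.sq_sqrt (Nat.cast_nonneg d)]
  simp [mul_comm]

theorem IsCube.convex {K : Set (EuclideanSpace ℝ (Fin d))} (hK : IsCube K) : Convex ℝ K := by
  obtain ⟨z, s, -, rfl⟩ := hK
  exact convex_box z s

theorem IsCube.isBounded {K : Set (EuclideanSpace ℝ (Fin d))} (hK : IsCube K) :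
    Bornology.IsBounded K := by
  obtain ⟨z, s, hs, rfl⟩ := hK
  exact Metric.isBounded_iff.2 ⟨_, fun _ hy _ hz => dist_le_of_mem_box hs.le hy hz⟩

/-- A segment leaving a box meets its frontier. -/
theorem exists_mem_segment_frontier_box {p q : EuclideanSpace ℝ (Fin d)} (hp : p ∈ box x a)
    (hq : q ∉ box x a) : ∃ r ∈ segment ℝ p q, r ∈ frontier (box x a) :=
  (convex_segment p q).isPreconnected.inter_frontier_nonempty
    ⟨p, left_mem_segment ℝ p q, hp⟩ ⟨q, right_mem_segment ℝ p q, hq⟩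

namespace ContainsWall

variable {W K : Set (EuclideanSpace ℝ (Fin d))}

theorem exists_mem_box (h : ContainsWall W K x a b) (hab : a < b)
    (hne : (K ∩ frontier (box x b)).Nonempty) {p : EuclideanSpace ℝ (Fin d)}
    (hp : p ∈ box x a) : ∃ z ∈ W, z ∈ box x b := by
  obtain ⟨q, hqK, hq⟩ := hne
  obtain ⟨r, -, hr⟩ := exists_mem_segment_frontier_box hp
    (fun hqa => hq.2 (box_subset_interior hab hqa))
  obtain ⟨z, hz⟩ := h r hr q ⟨hqK, hq⟩
  exact ⟨z, hz.1.1.1.2, hz.2.1⟩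

/-- Every edge that crosses a wall is the strictly longest edge of a triangle whose third vertex
belongs to the wall. -/
theorem exists_dist_lt (h : ContainsWall W K x a b) (hab : a < b) (hK : Convex ℝ K)
    (haK : box x a ⊆ K) {p q : EuclideanSpace ℝ (Fin d)} (hp : p ∈ box x a) (hqK : q ∈ K)
    (hq : q ∉ box x b) : ∃ z ∈ W, dist z p < dist p q ∧ dist z q < dist p q := by
  obtain ⟨p₁, hp₁, hp₁f⟩ :=
    exists_mem_segment_frontier_box hp (fun hqa => hq (box_mono hab.le hqa))
  have hp₁a : p₁ ∈ box x a := (isClosed_box x a).frontier_subset hp₁f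
  obtain ⟨p₂, hp₂, hp₂f⟩ := exists_mem_segment_frontier_box (box_mono hab.le hp₁a) hq
  have hp₂K : p₂ ∈ K := hK.segment_subset (haK hp₁a) hqK hp₂
  have hpos : 0 < dist p₁ p₂ := by
    refine dist_pos.2 ?_
    rintro rfl
    exact hp₂f.2 (box_subset_interior hab hp₁a)
  obtain ⟨z, ⟨⟨⟨-, hzW⟩, hz₁⟩, hz₂⟩, -⟩ := h p₁ hp₁f p₂ ⟨hp₂K, hp₂f⟩
  rw [mem_closedBall] at hz₁ hz₂
  have h₁ := dist_add_dist_of_mem_segment hp₁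
  have h₂ := dist_add_dist_of_mem_segment hp₂
  refine ⟨z, hzW, ?_, ?_⟩
  · linarith [dist_triangle z p₁ p, dist_comm p₁ p, dist_nonneg (x := p₂) (y := q)]
  · linarith [dist_triangle z p₂ q, dist_nonneg (x := p) (y := p₁)]

end ContainsWall

end Walls

/-- **Stability of the MST weight under adding points behind a wall**
(Chatterjee–Sen, Lemma 6.4).  There is a constant `c` depending only on `d` such that
for all `b > a > 0`, `x`, every cube `K ⊇ B(x,a)` with `K ∩ ∂B(x,b) ≠ ∅`, and all
finite sets `𝒜 ⊆ B(x,a)`, `ℬ ⊆ K \ B(x,a)`: if `ℬ` contains a `K`-wall around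
`B(x,a)` in `B(x,b)` then `|M(𝒜 ∪ ℬ) − M(ℬ)| ≤ c|𝒜|b`, and otherwise
`|M(𝒜 ∪ ℬ) − M(ℬ)| ≤ c|𝒜|·diam(K)`. -/
theorem mst_weight_stability_wall
    {d : ℕ} :
    ∃ c : ℝ, 0 < c ∧
      ∀ (x : EuclideanSpace ℝ (Fin d)) (a b : ℝ), 0 < a → a < b →
      ∀ K : Set (EuclideanSpace ℝ (Fin d)), IsCube K →
        box x a ⊆ K → (K ∩ frontier (box x b)).Nonempty →
      ∀ 𝒜 ℬ : Finset (EuclideanSpace ℝ (Fin d)),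
        (𝒜 : Set (EuclideanSpace ℝ (Fin d))) ⊆ box x a →
        (ℬ : Set (EuclideanSpace ℝ (Fin d))) ⊆ K \ box x a →
        (ContainsWall (ℬ : Set (EuclideanSpace ℝ (Fin d))) K x a b →
          |euclMST ((𝒜 : Set (EuclideanSpace ℝ (Fin d))) ∪ (ℬ : Set (EuclideanSpace ℝ (Fin d)))) -
              euclMST ((ℬ : Set (EuclideanSpace ℝ (Fin d))))| ≤
            c * 𝒜.card * b) ∧
        (¬ ContainsWall (ℬ : Set (EuclideanSpace ℝ (Fin d))) K x a b →
          |euclMST ((𝒜 : Set (EuclideanSpace ℝ (Fin d))) ∪ (ℬ : Set (EuclideanSpace ℝ (Fin d)))) -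
              euclMST ((ℬ : Set (EuclideanSpace ℝ (Fin d))))| ≤
            c * 𝒜.card * Metric.diam K) := by
  refine ⟨5 ^ d * 4 * (√d + 1), by positivity, ?_⟩
  intro x a b ha hab K hK haK hne 𝒜 ℬ h𝒜 hℬ
  have hb : 0 ≤ b := (ha.trans hab).le
  have hdisj : Disjoint 𝒜 ℬ :=
    Finset.disjoint_left.2 fun p hp𝒜 hpℬ => (hℬ hpℬ).2 (h𝒜 hp𝒜)
  constructor
  · intro hwall
    have h𝒜b : ∀ p ∈ 𝒜, p ∈ box x b := fun p hp => box_mono hab.le (h𝒜 hp)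
    refine (abs_euclMST_union_sub_le (D := 2 * b * √d) hdisj (by positivity)
      (fun p hp q hq => dist_le_of_mem_box hb (h𝒜b p hp) (h𝒜b q hq)) (fun p hp _ => ?_)
      (fun p hp q hq hlt => ?_)).trans ?_
    · obtain ⟨z, hz, hzb⟩ := hwall.exists_mem_box hab hne (h𝒜 hp)
      exact ⟨z, hz, dist_le_of_mem_box hb (h𝒜b p hp) hzb⟩
    · exact hwall.exists_dist_lt hab hK.convex haK (h𝒜 hp) (hℬ hq).1
        fun hqb => absurd (dist_le_of_mem_box hb (h𝒜b p hp) hqb) (not_le.2 hlt)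
    · have : 0 ≤ (5 : ℝ) ^ d * 4 * 𝒜.card * b := by positivity
      linarith
  · intro _
    have h𝒜K : ∀ p ∈ 𝒜, p ∈ K := fun p hp => haK (h𝒜 hp)
    refine (abs_euclMST_union_sub_le (D := Metric.diam K) hdisj Metric.diam_nonneg
      (fun p hp q hq => Metric.dist_le_diam_of_mem hK.isBounded (h𝒜K p hp) (h𝒜K q hq))
      (fun p hp ⟨q, hq⟩ => ⟨q, hq, Metric.dist_le_diam_of_mem hK.isBounded (h𝒜K p hp) (hℬ hq).1⟩)
      (fun p hp q hq hlt => absurd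
        (Metric.dist_le_diam_of_mem hK.isBounded (h𝒜K p hp) (hℬ hq).1) (not_le.2 hlt))).trans ?_
    have : 0 ≤ (5 : ℝ) ^ d * 𝒜.card * Metric.diam K * (4 * √d + 2) := by
      have := Metric.diam_nonneg (s := K)
      positivity
    linarith
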